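/- arXiv:1108.3000 — 4 statements merged into one kernel-verified Lean document; each statement's English description precedes it below -/
import Mathlib

section
/- Let x, y, z, u, v, w be vectors in ℝ³ with dim span{x,y,z} = 2 = dim span{u,v,w}. Put I₁ = span{x,v} ∩ span{y,u}, I₂ = span{x,w} ∩ span{z,u}, I₃ = span{z,v} ∩ span{y,w}. If I₁ and I₂ are distinct one-dimensional subspaces of ℝ³, and L is a two-dimensional subspace of ℝ³ with I₁ ≤ L and I₂ ≤ L, then I₃ ≤ L. -/
open Matrix Submodule

theorem left_mem_span_pair (a b : Fin 3 → ℝ) : a ∈ span ℝ {a, b} :=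
  subset_span (Set.mem_insert a {b})

theorem right_mem_span_pair (a b : Fin 3 → ℝ) : b ∈ span ℝ {a, b} :=
  subset_span (Set.mem_insert_of_mem a rfl)

theorem exists_eq_span_singleton_of_finrank_eq_one {S : Submodule ℝ (Fin 3 → ℝ)}
    (h : Module.finrank ℝ S = 1) : ∃ t : Fin 3 → ℝ, t ≠ 0 ∧ S = span ℝ {t} := by
  obtain ⟨⟨t, ht⟩, ht0, hS⟩ := finrank_eq_one_iff'.1 h
  refine ⟨t, fun h0 ↦ ht0 (Subtype.ext h0), le_antisymm (fun r hr ↦ ?_) ?_⟩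
  · obtain ⟨k, hk⟩ := hS ⟨r, hr⟩
    exact mem_span_singleton.2 ⟨k, congrArg Subtype.val hk⟩
  · exact (span_singleton_le_iff_mem t S).2 ht

section CrossProduct

variable {a b c d n t : Fin 3 → ℝ}

theorem exists_eq_smul_of_cross_eq_zero (h : a ⨯₃ b = 0) (ha : a ≠ 0) : ∃ s : ℝ, b = s • a := by
  have haa : a ⬝ᵥ a ≠ 0 := mt dotProduct_self_eq_zero.1 ha
  have key := cross_cross_eq_smul_sub_smul' a a b
  rw [h, map_zero, eq_comm, sub_eq_zero] at key
  refine ⟨(a ⬝ᵥ a)⁻¹ * (a ⬝ᵥ b), ?_⟩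
  rw [mul_smul, key, inv_smul_smul₀ haa]

theorem triple_product_smul_eq (a b c n : Fin 3 → ℝ) :
    (a ⬝ᵥ b ⨯₃ c) • n =
      (n ⬝ᵥ a) • b ⨯₃ c + (n ⬝ᵥ b) • c ⨯₃ a + (n ⬝ᵥ c) • a ⨯₃ b := by
  simp only [cross_apply, vec3_dotProduct]
  ext i
  fin_cases i <;> simp <;> ring

theorem triple_product_eq_zero_of_dotProduct (hn : n ≠ 0) (ha : n ⬝ᵥ a = 0) (hb : n ⬝ᵥ b = 0)
    (hc : n ⬝ᵥ c = 0) : a ⬝ᵥ b ⨯₃ c = 0 := by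
  have h := triple_product_smul_eq a b c n
  simpa [ha, hb, hc, hn] using h

theorem cross_dotProduct_of_mem_span_pair (h : t ∈ span ℝ {a, b}) : a ⨯₃ b ⬝ᵥ t = 0 := by
  obtain ⟨k, l, rfl⟩ := mem_span_pair.1 h
  simp [dotProduct_comm (a ⨯₃ b)]

theorem mem_span_pair_of_cross_dotProduct (hab : a ⨯₃ b ≠ 0) (h : a ⨯₃ b ⬝ᵥ t = 0) :
    t ∈ span ℝ {a, b} := by
  have hnn : a ⨯₃ b ⬝ᵥ a ⨯₃ b ≠ 0 := mt dotProduct_self_eq_zero.1 hab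
  have key : (a ⨯₃ b ⬝ᵥ a ⨯₃ b) • t =
      (t ⬝ᵥ b ⨯₃ (a ⨯₃ b)) • a + (a ⬝ᵥ t ⨯₃ (a ⨯₃ b)) • b + (a ⨯₃ b ⬝ᵥ t) • a ⨯₃ b := by
    simp only [cross_apply, vec3_dotProduct]
    ext i
    fin_cases i <;> simp <;> ring
  rw [h, zero_smul, add_zero] at key
  exact ((span ℝ {a, b}).smul_mem_iff hnn).1 (key ▸ mem_span_pair.2 ⟨_, _, rfl⟩)

theorem mem_span_pair_of_triple_product (hab : a ⨯₃ b ≠ 0) (h : a ⬝ᵥ b ⨯₃ t = 0) :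
    t ∈ span ℝ {a, b} :=
  mem_span_pair_of_cross_dotProduct hab <| by
    rw [dotProduct_comm, triple_product_permutation, h]

theorem exists_eq_smul_cross_cross (h : (a ⨯₃ b) ⨯₃ (c ⨯₃ d) ≠ 0) (hab : t ∈ span ℝ {a, b})
    (hcd : t ∈ span ℝ {c, d}) : ∃ k : ℝ, t = k • (a ⨯₃ b) ⨯₃ (c ⨯₃ d) := by
  refine exists_eq_smul_of_cross_eq_zero ?_ h
  rw [cross_cross_eq_smul_sub_smul, cross_dotProduct_of_mem_span_pair hab,
    cross_dotProduct_of_mem_span_pair hcd]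
  simp

/-- If two pairs of vectors span planes with parallel normals, the two planes coincide. -/
theorem mem_span_pair_of_cross_cross_eq_zero (hab : a ⨯₃ b ≠ 0) (hcd : c ⨯₃ d ≠ 0)
    (h : (a ⨯₃ b) ⨯₃ (c ⨯₃ d) = 0) : c ∈ span ℝ {a, b} ∧ d ∈ span ℝ {a, b} := by
  obtain ⟨s, hs⟩ := exists_eq_smul_of_cross_eq_zero (b := a ⨯₃ b)
    (by rw [← cross_anticomm, h, neg_zero]) hcd
  constructor <;> refine mem_span_pair_of_cross_dotProduct hab ?_ <;>
    simp [hs, dotProduct_comm (c ⨯₃ d)]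

theorem triple_product_eq_zero_of_finrank_span
    (h : Module.finrank ℝ (span ℝ ({a, b, c} : Set (Fin 3 → ℝ))) = 2) : a ⬝ᵥ b ⨯₃ c = 0 := by
  by_contra hne
  rw [triple_product_eq_det] at hne
  have hli : LinearIndependent ℝ ![a, b, c] :=
    Matrix.linearIndependent_rows_of_det_ne_zero (A := ![a, b, c]) hne
  have hcard := finrank_span_eq_card hli
  have hrange : Set.range ![a, b, c] = {a, b, c} := by
    rw [Matrix.range_cons, Matrix.range_cons_cons_empty, Set.singleton_union]
  rw [hrange, h] at hcard
  simp at hcard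

/-- The three-term Grassmann–Plücker relation when one of the triple products vanishes. -/
theorem triple_product_mul_eq_of_eq_zero (h : a ⬝ᵥ b ⨯₃ c = 0) (d e : Fin 3 → ℝ) :
    (a ⬝ᵥ b ⨯₃ d) * (a ⬝ᵥ e ⨯₃ c) = (a ⬝ᵥ c ⨯₃ d) * (a ⬝ᵥ e ⨯₃ b) := by
  have key : (a ⬝ᵥ b ⨯₃ d) * (a ⬝ᵥ e ⨯₃ c) - (a ⬝ᵥ c ⨯₃ d) * (a ⬝ᵥ e ⨯₃ b) =
      (a ⬝ᵥ b ⨯₃ c) * (a ⬝ᵥ e ⨯₃ d) := by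
    simp only [cross_apply, vec3_dotProduct, cons_val]
    ring
  rwa [h, zero_mul, sub_eq_zero] at key

/-- The determinant form of **Pappus' theorem**. -/
theorem pappus_triple_product {x y z u v w : Fin 3 → ℝ} (hxyz : x ⬝ᵥ y ⨯₃ z = 0)
    (huvw : u ⬝ᵥ v ⨯₃ w = 0) :
    ((x ⨯₃ v) ⨯₃ (y ⨯₃ u)) ⬝ᵥ ((x ⨯₃ w) ⨯₃ (z ⨯₃ u)) ⨯₃ ((z ⨯₃ v) ⨯₃ (y ⨯₃ w)) = 0 := by
  have expand (α β γ δ ε ζ η θ ι κ : ℝ) (p q r : Fin 3 → ℝ) (hp : p = α • v - β • x)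
      (hq : q = γ • w - δ • x) (hq' : q = ε • z - ζ • u) (hr : r = η • v - θ • z)
      (hr' : r = ι • y - κ • w) :
      p ⬝ᵥ q ⨯₃ r = α * ζ * θ * (v ⬝ᵥ u ⨯₃ z) - β * γ * ι * (x ⬝ᵥ w ⨯₃ y) := by
    have hx : x ⬝ᵥ q ⨯₃ r = γ * ι * (x ⬝ᵥ w ⨯₃ y) := by
      rw [hq, hr']
      simp [mul_assoc]
    have hv : v ⬝ᵥ q ⨯₃ r = ζ * θ * (v ⬝ᵥ u ⨯₃ z) := by
      rw [hr, hq']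
      simp [mul_assoc]
    rw [hp, sub_dotProduct, smul_dotProduct, smul_dotProduct, hx, hv]
    simp only [smul_eq_mul]
    ring
  have hx := triple_product_mul_eq_of_eq_zero hxyz u w
  have hv := triple_product_mul_eq_of_eq_zero
    (show v ⬝ᵥ w ⨯₃ u = 0 by rw [← triple_product_permutation, huvw]) z y
  have hz : z ⬝ᵥ x ⨯₃ w = x ⬝ᵥ w ⨯₃ z := triple_product_permutation z x w
  have hw : z ⨯₃ v ⬝ᵥ w = v ⬝ᵥ w ⨯₃ z := by
    rw [dotProduct_comm, triple_product_permutation, triple_product_permutation]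
  rw [expand _ _ _ _ _ _ _ _ _ _ _ _ _ (cross_cross_eq_smul_sub_smul ..)
    (cross_cross_eq_smul_sub_smul ..) (cross_cross_eq_smul_sub_smul' ..)
    (cross_cross_eq_smul_sub_smul ..) (cross_cross_eq_smul_sub_smul' ..), hz, hw]
  linear_combination (v ⬝ᵥ y ⨯₃ w) * (v ⬝ᵥ u ⨯₃ z) * hx -
    (x ⬝ᵥ z ⨯₃ u) * (x ⬝ᵥ w ⨯₃ y) * hv

end CrossProduct

/-- The points `p` and `q` are the first two intersection points of a Pappus hexagon whose vertices
lie alternately on the lines through `x, y, z` and through `u, v, w`. -/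
structure PappusConfig (x y z u v w p q : Fin 3 → ℝ) : Prop where
  xyz : x ⬝ᵥ y ⨯₃ z = 0
  uvw : u ⬝ᵥ v ⨯₃ w = 0
  left : span ℝ {x, v} ⊓ span ℝ {y, u} = span ℝ {p}
  right : span ℝ {x, w} ⊓ span ℝ {z, u} = span ℝ {q}
  indep : p ⨯₃ q ≠ 0

namespace PappusConfig

variable {x y z u v w p q r : Fin 3 → ℝ} {L : Submodule ℝ (Fin 3 → ℝ)}

theorem swap (h : PappusConfig x y z u v w p q) : PappusConfig u v w x y z p q where
  xyz := h.uvw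
  uvw := h.xyz
  left := by rw [Set.pair_comm u, Set.pair_comm v, inf_comm, h.left]
  right := by rw [Set.pair_comm u, Set.pair_comm w, inf_comm, h.right]
  indep := h.indep

theorem reflect (h : PappusConfig x y z u v w p q) : PappusConfig x z y u w v q p where
  xyz := by rw [← cross_anticomm, dotProduct_neg, h.xyz, neg_zero]
  uvw := by rw [← cross_anticomm, dotProduct_neg, h.uvw, neg_zero]
  left := h.right
  right := h.left
  indep := by rw [← cross_anticomm, neg_ne_zero]; exact h.indep

theorem mem_left (h : PappusConfig x y z u v w p q) : p ∈ span ℝ {x, v} ∧ p ∈ span ℝ {y, u} :=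
  mem_inf.1 (h.left ▸ mem_span_singleton_self p)

theorem mem_right (h : PappusConfig x y z u v w p q) : q ∈ span ℝ {x, w} ∧ q ∈ span ℝ {z, u} :=
  h.reflect.mem_left

theorem exists_smul_left (h : PappusConfig x y z u v w p q) {t : Fin 3 → ℝ}
    (h₁ : t ∈ span ℝ {x, v}) (h₂ : t ∈ span ℝ {y, u}) : ∃ k : ℝ, k • p = t :=
  mem_span_singleton.1 (h.left ▸ mem_inf.2 ⟨h₁, h₂⟩)

theorem cross_cross_ne_zero (h : PappusConfig x y z u v w p q) (hxv : x ⨯₃ v ≠ 0)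
    (hyu : y ⨯₃ u ≠ 0) : (x ⨯₃ v) ⨯₃ (y ⨯₃ u) ≠ 0 := by
  intro h0
  obtain ⟨hx, hv⟩ := mem_span_pair_of_cross_cross_eq_zero hyu hxv
    (by rw [← cross_anticomm, h0, neg_zero])
  obtain ⟨k, rfl⟩ := h.exists_smul_left (left_mem_span_pair x v) hx
  obtain ⟨l, rfl⟩ := h.exists_smul_left (right_mem_span_pair _ v) hv
  simp at hxv

/-- Pappus' theorem when the side through `x` and `v` is degenerate. -/
theorem mem_of_cross_xv_eq_zero (h : PappusConfig x y z u v w p q) (hxv : x ⨯₃ v = 0)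
    (hp : p ∈ L) (hq : q ∈ L) (h₁ : r ∈ span ℝ {z, v}) (h₂ : r ∈ span ℝ {y, w}) : r ∈ L := by
  have hpq := h.indep
  obtain ⟨a, b, hab⟩ := mem_span_pair.1 h.mem_left.1
  obtain ⟨c, d, hcd⟩ := mem_span_pair.1 h.mem_left.2
  obtain ⟨e, f, hef⟩ := mem_span_pair.1 h.mem_right.1
  obtain ⟨g, i, hgi⟩ := mem_span_pair.1 h.mem_right.2
  have hyw : y ∈ L → w ∈ L → r ∈ L := fun hy hw ↦
    span_le.2 (Set.pair_subset hy hw) h₂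
  have hzv : z ∈ L → v ∈ L → r ∈ L := fun hz hv ↦
    span_le.2 (Set.pair_subset hz hv) h₁
  by_cases hx : x = 0
  · subst hx
    rw [smul_zero, zero_add] at hab hef
    have hb : b ≠ 0 := by rintro rfl; simp [← hab] at hpq
    have hf : f ≠ 0 := by rintro rfl; simp [← hef] at hpq
    have hv : v ∈ L := (L.smul_mem_iff hb).1 (hab ▸ hp)
    have hw : w ∈ L := (L.smul_mem_iff hf).1 (hef ▸ hq)
    have hvw : v ⨯₃ w ≠ 0 := by intro h0; simp [← hab, ← hef, h0] at hpq
    have hu : u ∈ L := span_le.2 (Set.pair_subset hv hw)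
      (mem_span_pair_of_triple_product hvw (by rw [← triple_product_permutation, h.uvw]))
    by_cases hc : c = 0
    · by_cases hg : g = 0
      · simp [← hcd, ← hgi, hc, hg] at hpq
      · refine hzv ((L.smul_mem_iff hg).1 ?_) hv
        rw [eq_sub_of_add_eq hgi]
        exact L.sub_mem hq (L.smul_mem _ hu)
    · refine hyw ((L.smul_mem_iff hc).1 ?_) hw
      rw [eq_sub_of_add_eq hcd]
      exact L.sub_mem hp (L.smul_mem _ hu)
  · obtain ⟨s, rfl⟩ := exists_eq_smul_of_cross_eq_zero hxv hx
    have hpx : p = (a + b * s) • x := by rw [← hab]; module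
    have hk : a + b * s ≠ 0 := by intro h0; simp [hpx, h0] at hpq
    have hxL : x ∈ L := (L.smul_mem_iff hk).1 (hpx ▸ hp)
    have hxyu : x ∈ span ℝ {y, u} :=
      ((span ℝ {y, u}).smul_mem_iff hk).1 (hpx ▸ h.mem_left.2)
    have hf : f ≠ 0 := by rintro rfl; simp [← hef, hpx] at hpq
    have hw : w ∈ L := by
      refine (L.smul_mem_iff hf).1 ?_
      rw [eq_sub_of_add_eq' hef]
      exact L.sub_mem hq (L.smul_mem _ hxL)
    refine hyw ?_ hw
    by_contra hy
    obtain ⟨k, l, hkl⟩ := mem_span_pair.1 hxyu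
    have hl : l ≠ 0 := by
      rintro rfl
      rw [zero_smul, add_zero] at hkl
      have hk0 : k ≠ 0 := by rintro rfl; exact hx (by simp [← hkl])
      exact hy ((L.smul_mem_iff hk0).1 (hkl ▸ hxL))
    have hxy : x ⨯₃ y ≠ 0 := by
      intro h0
      obtain ⟨t, rfl⟩ := exists_eq_smul_of_cross_eq_zero h0 hx
      exact hy (L.smul_mem _ hxL)
    have hz : z ∈ span ℝ {x, y} := mem_span_pair_of_triple_product hxy h.xyz
    have hu : u ∈ span ℝ {x, y} := by
      refine ((span ℝ {x, y}).smul_mem_iff hl).1 ?_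
      rw [eq_sub_of_add_eq' hkl]
      exact sub_mem (left_mem_span_pair x y) (smul_mem _ _ (right_mem_span_pair x y))
    obtain ⟨m, n, hmn⟩ := mem_span_pair.1 (span_le.2 (Set.pair_subset hz hu) h.mem_right.2)
    have hn : n ≠ 0 := by rintro rfl; simp [← hmn, hpx] at hpq
    refine hy ((L.smul_mem_iff hn).1 ?_)
    rw [eq_sub_of_add_eq' hmn]
    exact L.sub_mem hq (L.smul_mem _ hxL)

/-- Pappus' theorem when only the side through `z` and `v` is degenerate. -/
theorem mem_of_cross_zv_eq_zero (h : PappusConfig x y z u v w p q) (hxv : x ⨯₃ v ≠ 0)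
    (huz : u ⨯₃ z ≠ 0) (hzv : z ⨯₃ v = 0)
    (hp : p ∈ L) (hq : q ∈ L) (h₂ : r ∈ span ℝ {y, w}) : r ∈ L := by
  have hz : z ≠ 0 := by rintro rfl; simp at huz
  obtain ⟨s, rfl⟩ := exists_eq_smul_of_cross_eq_zero hzv hz
  have hs : s ≠ 0 := by rintro rfl; simp at hxv
  have hy : y ∈ span ℝ {x, s • z} := by
    refine mem_span_pair_of_triple_product hxv ?_
    rw [map_smul, LinearMap.smul_apply, dotProduct_smul, h.reflect.xyz, smul_zero]
  have hw : w ∈ span ℝ {z, u} := by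
    rw [Set.pair_comm]
    refine mem_span_pair_of_triple_product huz ?_
    simpa [hs] using h.uvw
  obtain ⟨k, rfl⟩ := h.exists_smul_left hy (left_mem_span_pair y u)
  obtain ⟨l, rfl⟩ := h.reflect.exists_smul_left (right_mem_span_pair x w) hw
  exact span_le.2 (Set.pair_subset (L.smul_mem k hp) (L.smul_mem l hq)) h₂

/-- Pappus' theorem when the sides through `z, v` and through `y, w` coincide. -/
theorem mem_of_cross_cross_eq_zero (h : PappusConfig x y z u v w p q) (hzv : z ⨯₃ v ≠ 0)
    (hyw : y ⨯₃ w ≠ 0) (h0 : (z ⨯₃ v) ⨯₃ (y ⨯₃ w) = 0)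
    (h₁ : r ∈ span ℝ {z, v}) : r ∈ span ℝ {p, q} := by
  obtain ⟨hy, hw⟩ := mem_span_pair_of_cross_cross_eq_zero hzv hyw h0
  have hz : z ∈ span ℝ {z, v} := left_mem_span_pair z v
  have hv : v ∈ span ℝ {z, v} := right_mem_span_pair z v
  have hpq : p ∈ span ℝ {z, v} ∧ q ∈ span ℝ {z, v} := by
    by_cases hyz : y ⨯₃ z = 0
    · by_cases hvw : v ⨯₃ w = 0
      · have hy0 : y ≠ 0 := by rintro rfl; simp at hyw
        have hv0 : v ≠ 0 := by rintro rfl; simp at hzv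
        obtain ⟨s, rfl⟩ := exists_eq_smul_of_cross_eq_zero hyz hy0
        obtain ⟨t, rfl⟩ := exists_eq_smul_of_cross_eq_zero hvw hv0
        have hq₁ : q ∈ span ℝ {x, v} := span_le.2 (Set.pair_subset (left_mem_span_pair x v)
          (smul_mem _ _ (right_mem_span_pair x v))) h.mem_right.1
        have hq₂ : q ∈ span ℝ {y, u} := span_le.2 (Set.pair_subset
          (smul_mem _ _ (left_mem_span_pair y u)) (right_mem_span_pair y u)) h.mem_right.2
        obtain ⟨k, rfl⟩ := h.exists_smul_left hq₁ hq₂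
        exact absurd h.indep (by simp)
      · have hu : u ∈ span ℝ {z, v} := span_le.2 (Set.pair_subset hv hw)
          (mem_span_pair_of_triple_product hvw (by rw [← triple_product_permutation, h.uvw]))
        exact ⟨span_le.2 (Set.pair_subset hy hu) h.mem_left.2,
          span_le.2 (Set.pair_subset hz hu) h.mem_right.2⟩
    · have hx : x ∈ span ℝ {z, v} := span_le.2 (Set.pair_subset hy hz)
        (mem_span_pair_of_triple_product hyz (by rw [← triple_product_permutation, h.xyz]))
      exact ⟨span_le.2 (Set.pair_subset hx hv) h.mem_left.1,
        span_le.2 (Set.pair_subset hx hw) h.mem_right.1⟩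
  exact mem_span_pair_of_triple_product h.indep <| triple_product_eq_zero_of_dotProduct hzv
    (cross_dotProduct_of_mem_span_pair hpq.1) (cross_dotProduct_of_mem_span_pair hpq.2)
    (cross_dotProduct_of_mem_span_pair h₁)

/-- **Pappus' theorem**: the third intersection point lies on every line through the first two. -/
theorem mem (h : PappusConfig x y z u v w p q) (hp : p ∈ L) (hq : q ∈ L)
    (h₁ : r ∈ span ℝ {z, v}) (h₂ : r ∈ span ℝ {y, w}) : r ∈ L := by
  have h₁' : r ∈ span ℝ {v, z} := Set.pair_comm z v ▸ h₁
  have h₂' : r ∈ span ℝ {w, y} := Set.pair_comm y w ▸ h₂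
  by_cases hxv : x ⨯₃ v = 0
  · exact h.mem_of_cross_xv_eq_zero hxv hp hq h₁ h₂
  by_cases hxw : x ⨯₃ w = 0
  · exact h.reflect.mem_of_cross_xv_eq_zero hxw hq hp h₂ h₁
  by_cases huy : u ⨯₃ y = 0
  · exact h.swap.mem_of_cross_xv_eq_zero huy hp hq h₂' h₁'
  by_cases huz : u ⨯₃ z = 0
  · exact h.swap.reflect.mem_of_cross_xv_eq_zero huz hq hp h₁' h₂'
  by_cases hzv : z ⨯₃ v = 0
  · exact h.mem_of_cross_zv_eq_zero hxv huz hzv hp hq h₂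
  by_cases hyw : y ⨯₃ w = 0
  · exact h.reflect.mem_of_cross_zv_eq_zero hxw huy hyw hq hp h₁
  have hpqL : span ℝ {p, q} ≤ L := span_le.2 (Set.pair_subset hp hq)
  by_cases h0 : (z ⨯₃ v) ⨯₃ (y ⨯₃ w) = 0
  · exact hpqL (h.mem_of_cross_cross_eq_zero hzv hyw h0 h₁)
  have hyu : y ⨯₃ u ≠ 0 := by rwa [← cross_anticomm, neg_ne_zero]
  have hzu : z ⨯₃ u ≠ 0 := by rwa [← cross_anticomm, neg_ne_zero]
  refine hpqL (mem_span_pair_of_triple_product h.indep ?_)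
  obtain ⟨a, ha⟩ := exists_eq_smul_cross_cross (h.cross_cross_ne_zero hxv hyu)
    h.mem_left.1 h.mem_left.2
  obtain ⟨b, hb⟩ := exists_eq_smul_cross_cross (h.reflect.cross_cross_ne_zero hxw hzu)
    h.mem_right.1 h.mem_right.2
  obtain ⟨c, hc⟩ := exists_eq_smul_cross_cross h0 h₁ h₂
  rw [ha, hb, hc]
  simp only [map_smul, LinearMap.smul_apply, smul_dotProduct, dotProduct_smul,
    pappus_triple_product h.xyz h.uvw, smul_zero]

end PappusConfig

/-- The form in which Pappus' theorem is applied to wirings: with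
`x, y, z` spanning a plane and `u, v, w` spanning a plane in `ℝ³`, set
`I₁ = span{x,v} ⊓ span{y,u}`, `I₂ = span{x,w} ⊓ span{z,u}`,
`I₃ = span{z,v} ⊓ span{y,w}`.  If `I₁` and `I₂` are distinct one-dimensional
subspaces both contained in a two-dimensional subspace `L`, then `I₃ ≤ L`. -/
theorem pappus_third_point_on_line (x y z u v w : Fin 3 → ℝ)
    (hxyz : Module.finrank ℝ ↥(Submodule.span ℝ ({x, y, z} : Set (Fin 3 → ℝ))) = 2)
    (huvw : Module.finrank ℝ ↥(Submodule.span ℝ ({u, v, w} : Set (Fin 3 → ℝ))) = 2)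
    (I₁ I₂ I₃ L : Submodule ℝ (Fin 3 → ℝ))
    (hI₁ : I₁ = Submodule.span ℝ ({x, v} : Set (Fin 3 → ℝ)) ⊓ Submodule.span ℝ ({y, u} : Set (Fin 3 → ℝ)))
    (hI₂ : I₂ = Submodule.span ℝ ({x, w} : Set (Fin 3 → ℝ)) ⊓ Submodule.span ℝ ({z, u} : Set (Fin 3 → ℝ)))
    (hI₃ : I₃ = Submodule.span ℝ ({z, v} : Set (Fin 3 → ℝ)) ⊓ Submodule.span ℝ ({y, w} : Set (Fin 3 → ℝ)))
    (hd₁ : Module.finrank ℝ ↥I₁ = 1) (hd₂ : Module.finrank ℝ ↥I₂ = 1)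
    (hne : I₁ ≠ I₂)
    (hL : Module.finrank ℝ ↥L = 2) (hI₁L : I₁ ≤ L) (hI₂L : I₂ ≤ L) :
    I₃ ≤ L := by
  subst hI₁ hI₂ hI₃
  obtain ⟨p, hp0, hp⟩ := exists_eq_span_singleton_of_finrank_eq_one hd₁
  obtain ⟨q, hq0, hq⟩ := exists_eq_span_singleton_of_finrank_eq_one hd₂
  have hconfig : PappusConfig x y z u v w p q :=
    { xyz := triple_product_eq_zero_of_finrank_span hxyz
      uvw := triple_product_eq_zero_of_finrank_span huvw
      left := hp
      right := hq
      indep := by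
        intro h0
        obtain ⟨s, rfl⟩ := exists_eq_smul_of_cross_eq_zero h0 hp0
        have hs : s ≠ 0 := by rintro rfl; simp at hq0
        rw [span_singleton_smul_eq hs.isUnit] at hq
        exact hne (hp.trans hq.symm) }
  exact fun r hr ↦ hconfig.mem (hI₁L (mem_inf.2 hconfig.mem_left))
    (hI₂L (mem_inf.2 hconfig.mem_right)) hr.1 hr.2
end

section
/- Let Σ = (σ₀, σ₁, …, σ_m) be an allowable sequence in S_n with pair sequence ((a₁,b₁), …, (a_m,b_m)), and suppose for some index 1 ≤ i < m the intervals of the i-th and (i+1)-st moves are disjoint, i.e. b_{i+1} < a_i or b_i < a_{i+1}. Define τ ∈ S_n by τ(c) = σ_{i-1}(a_{i+1} + b_{i+1} − c) for a_{i+1} ≤ c ≤ b_{i+1} and τ(c) = σ_{i-1}(c) otherwise. Then Σ' = (σ₀, …, σ_{i-1}, τ, σ_{i+1}, …, σ_m) is again an allowable sequence in S_n, and its pair sequence is obtained from that of Σ by interchanging the i-th and (i+1)-st pairs. -/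
/-- An *allowable sequence* in `Sₙ` (Definition 2.1 of the paper), encoded 0-based:
positions and labels are elements of `Fin n` (position/label `i` corresponds to
`i + 1` in the paper), the permutations are `σ 0, σ 1, …, σ m : Equiv.Perm (Fin n)`,
and the pair sequence is `(a 0, b 0), …, (a (m-1), b (m-1))`
(the `k`-th move turns `σ k` into `σ (k+1)` by reversing the increasing segment
of positions `a k, a k + 1, …, b k`). -/
structure AllowableSequence (n m : ℕ) where
  /-- the permutations `σ₀, …, σ_m` -/
  σ : Fin (m + 1) → Equiv.Perm (Fin n)
  /-- left endpoints of the moves -/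
  a : Fin m → Fin n
  /-- right endpoints of the moves -/
  b : Fin m → Fin n
  /-- `σ₀` is the identity -/
  sigma_zero : σ 0 = 1
  /-- `σ_m` is the order-reversing permutation -/
  sigma_last : ∀ c : Fin n, σ (Fin.last m) c = c.rev
  /-- the intervals are nontrivial -/
  a_lt_b : ∀ i : Fin m, a i < b i
  /-- `σᵢ` is increasing on the interval `[aᵢ, bᵢ]` of the `i`-th move -/
  mono : ∀ i : Fin m, ∀ c d : Fin n, a i ≤ c → c < d → d ≤ b i →
    σ i.castSucc c < σ i.castSucc d
  /-- inside the interval, the `i`-th move reverses: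
  `σ_{i+1}(c) = σ_i(a_i + b_i - c)` -/
  move_in : ∀ i : Fin m, ∀ c d : Fin n, a i ≤ c → c ≤ b i →
    (d : ℕ) = (a i : ℕ) + (b i : ℕ) - (c : ℕ) → σ i.succ c = σ i.castSucc d
  /-- outside the interval, the `i`-th move changes nothing -/
  move_out : ∀ i : Fin m, ∀ c : Fin n, (c < a i ∨ b i < c) → σ i.succ c = σ i.castSucc c

/-- The permutation of `Fin n` reversing the positions `a, a + 1, …, b` and fixing all others. -/
def intervalRev {n : ℕ} (a b : Fin n) : Equiv.Perm (Fin n) :=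
  Function.Involutive.toPerm
    (fun c => if h : a ≤ c ∧ c ≤ b then ⟨(a : ℕ) + b - c, by have := h.1; omega⟩ else c) (by
      intro c
      by_cases h : a ≤ c ∧ c ≤ b
      · have h' : (a : ℕ) ≤ a + b - c ∧ (a : ℕ) + b - c ≤ b := by
          obtain ⟨h1, h2⟩ := h
          omega
        have h2 : (c : ℕ) ≤ b := h.2
        simp only [h, and_self, dite_true, Fin.le_def, h', Fin.ext_iff]
        omega
      · simp only [h, dite_false])

theorem intervalRev_apply_of_mem {n : ℕ} {a b c d : Fin n} (hac : a ≤ c) (hcb : c ≤ b)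
    (hd : (d : ℕ) = (a : ℕ) + b - c) : intervalRev a b c = d :=
  (dif_pos ⟨hac, hcb⟩).trans (Fin.ext hd.symm)

theorem intervalRev_apply_of_notMem {n : ℕ} {a b c : Fin n} (h : c < a ∨ b < c) :
    intervalRev a b c = c := by
  have hmem : ¬(a ≤ c ∧ c ≤ b) := by
    rintro ⟨h1, h2⟩
    omega
  exact dif_neg hmem

/-- `q` arises from `p` by reversing the nontrivial increasing segment of positions `a, …, b`. -/
structure IsMove {n : ℕ} (p q : Equiv.Perm (Fin n)) (a b : Fin n) : Prop where
  lt : a < b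
  mono : ∀ c d : Fin n, a ≤ c → c < d → d ≤ b → p c < p d
  move_in : ∀ c d : Fin n, a ≤ c → c ≤ b → (d : ℕ) = (a : ℕ) + (b : ℕ) - (c : ℕ) → q c = p d
  move_out : ∀ c : Fin n, (c < a ∨ b < c) → q c = p c

theorem AllowableSequence.isMove {n m : ℕ} (A : AllowableSequence n m) (i : Fin m) :
    IsMove (A.σ i.castSucc) (A.σ i.succ) (A.a i) (A.b i) :=
  ⟨A.a_lt_b i, A.mono i, A.move_in i, A.move_out i⟩

namespace IsMove

variable {n : ℕ} {p q r : Equiv.Perm (Fin n)} {a b a₂ b₂ : Fin n}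

/-- The second of two consecutive disjoint moves can be performed first. -/
theorem intervalRev_left (h : IsMove p q a b) (h' : IsMove q r a₂ b₂)
    (hdisj : b₂ < a ∨ b < a₂) : IsMove p (p * intervalRev a₂ b₂) a₂ b₂ where
  lt := h'.lt
  mono c d hc hcd hd := by
    rw [← h.move_out c (by omega), ← h.move_out d (by omega)]
    exact h'.mono c d hc hcd hd
  move_in c d hc hc' hd := by
    rw [Equiv.Perm.mul_apply, intervalRev_apply_of_mem hc hc' hd]
  move_out c hc := by
    rw [Equiv.Perm.mul_apply, intervalRev_apply_of_notMem hc]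

/-- The first of two consecutive disjoint moves can be performed second. -/
theorem intervalRev_right (h : IsMove p q a b) (h' : IsMove q r a₂ b₂)
    (hdisj : b₂ < a ∨ b < a₂) : IsMove (p * intervalRev a₂ b₂) r a b where
  lt := h.lt
  mono c d hc hcd hd := by
    rw [Equiv.Perm.mul_apply, Equiv.Perm.mul_apply,
      intervalRev_apply_of_notMem (by omega), intervalRev_apply_of_notMem (by omega)]
    exact h.mono c d hc hcd hd
  move_in c d hc hc' hd := by
    rw [Equiv.Perm.mul_apply, intervalRev_apply_of_notMem (by omega),
      h'.move_out c (by omega), h.move_in c d hc hc' hd]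
  move_out c hc := by
    rw [Equiv.Perm.mul_apply]
    by_cases hc' : a₂ ≤ c ∧ c ≤ b₂
    · obtain ⟨h1, h2⟩ := hc'
      let d : Fin n := ⟨(a₂ : ℕ) + b₂ - c, by omega⟩
      have hd : (d : ℕ) = (a₂ : ℕ) + b₂ - c := rfl
      rw [intervalRev_apply_of_mem h1 h2 hd, h'.move_in c d h1 h2 hd, h.move_out d (by omega)]
    · have hc'' : c < a₂ ∨ b₂ < c := by
        by_contra hcon
        exact hc' (by omega)
      rw [intervalRev_apply_of_notMem hc'', h'.move_out c hc'', h.move_out c hc]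

end IsMove

/-- Interchanging two consecutive moves with disjoint intervals.  If
`(a_j, b_j)` and `(a_{j+1}, b_{j+1})` are consecutive moves of an allowable
sequence whose intervals are disjoint (`b_{j+1} < a_j` or `b_j < a_{j+1}`), then
replacing the intermediate permutation by `τ`, where
`τ(c) = σ_j(a_{j+1} + b_{j+1} - c)` on `[a_{j+1}, b_{j+1}]` and `τ(c) = σ_j(c)`
otherwise, yields again an allowable sequence, whose pair sequence is obtained
by interchanging the `j`-th and `(j+1)`-st pairs. -/
theorem swap_disjoint_consecutive_moves (n m : ℕ) (A : AllowableSequence n m)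
    (j : ℕ) (hj : j + 1 < m)
    (hdisj : A.b ⟨j + 1, hj⟩ < A.a ⟨j, by omega⟩ ∨ A.b ⟨j, by omega⟩ < A.a ⟨j + 1, hj⟩) :
    ∃ A' : AllowableSequence n m,
      -- all permutations except the intermediate one are unchanged
      (∀ k : Fin (m + 1), (k : ℕ) ≠ j + 1 → A'.σ k = A.σ k) ∧
      -- the new intermediate permutation is `τ`:
      (∀ c d : Fin n, A.a ⟨j + 1, hj⟩ ≤ c → c ≤ A.b ⟨j + 1, hj⟩ →
        (d : ℕ) = (A.a ⟨j + 1, hj⟩ : ℕ) + (A.b ⟨j + 1, hj⟩ : ℕ) - (c : ℕ) →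
        A'.σ ⟨j + 1, by omega⟩ c = A.σ ⟨j, by omega⟩ d) ∧
      (∀ c : Fin n, (c < A.a ⟨j + 1, hj⟩ ∨ A.b ⟨j + 1, hj⟩ < c) →
        A'.σ ⟨j + 1, by omega⟩ c = A.σ ⟨j, by omega⟩ c) ∧
      -- the `j`-th and `(j+1)`-st pairs are interchanged, all other pairs unchanged
      A'.a ⟨j, by omega⟩ = A.a ⟨j + 1, hj⟩ ∧ A'.b ⟨j, by omega⟩ = A.b ⟨j + 1, hj⟩ ∧
      A'.a ⟨j + 1, hj⟩ = A.a ⟨j, by omega⟩ ∧ A'.b ⟨j + 1, hj⟩ = A.b ⟨j, by omega⟩ ∧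
      (∀ k : Fin m, (k : ℕ) ≠ j → (k : ℕ) ≠ j + 1 → A'.a k = A.a k ∧ A'.b k = A.b k) := by
  let i₀ : Fin m := ⟨j, by omega⟩
  let i₁ : Fin m := ⟨j + 1, hj⟩
  let s : Equiv.Perm (Fin m) := Equiv.swap i₀ i₁
  let τ : Equiv.Perm (Fin n) := A.σ i₀.castSucc * intervalRev (A.a i₁) (A.b i₁)
  let σ' : Fin (m + 1) → Equiv.Perm (Fin n) := Function.update A.σ i₁.castSucc τ
  have hσ_ne : ∀ k : Fin (m + 1), (k : ℕ) ≠ j + 1 → σ' k = A.σ k := fun k hk =>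
    Function.update_of_ne (fun h => hk (congrArg Fin.val h)) _ _
  have hσ_eq : σ' i₁.castSucc = τ := Function.update_self _ _ _
  have hs_ne : ∀ k : Fin m, (k : ℕ) ≠ j → (k : ℕ) ≠ j + 1 → s k = k := fun k h0 h1 =>
    Equiv.swap_apply_of_ne_of_ne (fun h => h0 (congrArg Fin.val h))
      (fun h => h1 (congrArg Fin.val h))
  have hs₀ : s i₀ = i₁ := Equiv.swap_apply_left _ _
  have hs₁ : s i₁ = i₀ := Equiv.swap_apply_right _ _
  have hτ_left : IsMove (A.σ i₀.castSucc) τ (A.a i₁) (A.b i₁) :=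
    (A.isMove i₀).intervalRev_left (A.isMove i₁) hdisj
  have hτ_right : IsMove τ (A.σ i₁.succ) (A.a i₀) (A.b i₀) :=
    (A.isMove i₀).intervalRev_right (A.isMove i₁) hdisj
  have hmove : ∀ i : Fin m, IsMove (σ' i.castSucc) (σ' i.succ) (A.a (s i)) (A.b (s i)) := by
    intro i
    by_cases h0 : (i : ℕ) = j
    · obtain rfl : i = i₀ := Fin.ext h0
      rw [hs₀, hσ_ne i₀.castSucc (by simp [i₀]), show i₀.succ = i₁.castSucc from rfl, hσ_eq]
      exact hτ_left
    by_cases h1 : (i : ℕ) = j + 1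
    · obtain rfl : i = i₁ := Fin.ext h1
      rw [hs₁, hσ_eq, hσ_ne i₁.succ (by simp [i₁])]
      exact hτ_right
    · rw [hs_ne i h0 h1, hσ_ne i.castSucc (by simpa using h1), hσ_ne i.succ (by simpa using h0)]
      exact A.isMove i
  exact ⟨{ σ := σ'
           a := fun i => A.a (s i)
           b := fun i => A.b (s i)
           sigma_zero := (hσ_ne 0 (by simp)).trans A.sigma_zero
           sigma_last := fun c => by
             rw [hσ_ne (Fin.last m) (by rw [Fin.val_last]; omega), A.sigma_last]
           a_lt_b := fun i => (hmove i).lt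
           mono := fun i => (hmove i).mono
           move_in := fun i => (hmove i).move_in
           move_out := fun i => (hmove i).move_out },
    hσ_ne,
    fun c d hc hc' hd => (DFunLike.congr_fun hσ_eq c).trans (hτ_left.move_in c d hc hc' hd),
    fun c hc => (DFunLike.congr_fun hσ_eq c).trans (hτ_left.move_out c hc),
    congrArg A.a hs₀, congrArg A.b hs₀, congrArg A.a hs₁, congrArg A.b hs₁,
    fun k h0 h1 => ⟨congrArg A.a (hs_ne k h0 h1), congrArg A.b (hs_ne k h0 h1)⟩⟩
end

section
/- Let Σ = (σ₀, σ₁, …, σ_m) be an allowable sequence in S_n with pair sequence ((a₁,b₁), …, (a_m,b_m)). Then for every 1 ≤ i < m, the integer intervals [a_i, b_i] and [a_{i+1}, b_{i+1}] intersect in at most one point, i.e. the set {c ∈ ℤ : a_i ≤ c ≤ b_i and a_{i+1} ≤ c ≤ b_{i+1}} has cardinality at most 1. -/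
/-- After the `i`-th move, the permutation is decreasing on the interval of that move. -/
theorem AllowableSequence.anti {n m : ℕ} (A : AllowableSequence n m) (i : Fin m) (c d : Fin n)
    (hac : A.a i ≤ c) (hcd : c < d) (hdb : d ≤ A.b i) : A.σ i.succ d < A.σ i.succ c := by
  have reflect_lt : ∀ e : Fin n, A.a i ≤ e → (A.a i : ℕ) + A.b i - e < n := by
    intro e he
    have := (A.b i).isLt
    rw [Fin.le_def] at he
    omega
  rw [A.move_in i c ⟨_, reflect_lt c hac⟩ hac (hcd.le.trans hdb) rfl,
    A.move_in i d ⟨_, reflect_lt d (hac.trans hcd.le)⟩ (hac.trans hcd.le) hdb rfl]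
  apply A.mono i <;> simp only [Fin.le_def, Fin.lt_def] at * <;> omega

/-- The intervals of two consecutive moves of an allowable sequence intersect in at
most one point. -/
theorem consecutive_intervals_subsingleton (n m : ℕ) (A : AllowableSequence n m)
    (i : ℕ) (hi : i + 1 < m) :
    Set.ncard {c : Fin n |
      A.a ⟨i, by omega⟩ ≤ c ∧ c ≤ A.b ⟨i, by omega⟩ ∧
      A.a ⟨i + 1, hi⟩ ≤ c ∧ c ≤ A.b ⟨i + 1, hi⟩} ≤ 1 := by
  rw [Set.ncard_le_one_iff_subsingleton]
  intro c ⟨hac, hcb, hac', hcb'⟩ d ⟨had, hdb, had', hdb'⟩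
  rcases lt_trichotomy c d with h | h | h
  · exact absurd (A.mono ⟨i + 1, hi⟩ c d hac' h hdb') (A.anti ⟨i, by omega⟩ c d hac h hdb).asymm
  · exact h
  · exact absurd (A.mono ⟨i + 1, hi⟩ d c had' h hcb') (A.anti ⟨i, by omega⟩ d c had h hcb).asymm
end

section
/- Let Σ = (σ₀, σ₁, …, σ_m) be an allowable sequence in S_n. For labels p, q with 1 ≤ p < q ≤ n, say that the pair (p,q) is inverted in a permutation σ if σ⁻¹(q) < σ⁻¹(p) (i.e. the label q occurs at an earlier position than p). Then: (1) once inverted, a pair stays inverted, i.e. if (p,q) is inverted in σ_i and i ≤ j ≤ m, then (p,q) is inverted in σ_j; and (2) for every pair p < q there exists exactly one index i ∈ {0,…,m−1} such that (p,q) is not inverted in σ_i but is inverted in σ_{i+1}. -/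
namespace AllowableSequence

variable {n m : ℕ} (A : AllowableSequence n m)

/-- A label outside the interval of a move keeps its position. -/
theorem inv_succ_of_outside (i : Fin m) (x : Fin n)
    (h : (A.σ i.castSucc)⁻¹ x < A.a i ∨ A.b i < (A.σ i.castSucc)⁻¹ x) :
    (A.σ i.succ)⁻¹ x = (A.σ i.castSucc)⁻¹ x := by
  rw [Equiv.Perm.inv_eq_iff_eq, A.move_out i _ h, Equiv.Perm.coe_inv, Equiv.apply_symm_apply]

/-- A label inside the interval `[a, b]` of a move goes from position `c` to `a + b - c`. -/
theorem inv_succ_of_inside (i : Fin m) (x : Fin n)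
    (ha : A.a i ≤ (A.σ i.castSucc)⁻¹ x) (hb : (A.σ i.castSucc)⁻¹ x ≤ A.b i) :
    ((A.σ i.succ)⁻¹ x : ℕ) = (A.a i : ℕ) + A.b i - ((A.σ i.castSucc)⁻¹ x : ℕ) := by
  have hlt : (A.a i : ℕ) + A.b i - ((A.σ i.castSucc)⁻¹ x : ℕ) < n := by lia
  have key : (A.σ i.succ)⁻¹ x = ⟨_, hlt⟩ := by
    rw [Equiv.Perm.inv_eq_iff_eq, A.move_in i ⟨_, hlt⟩ ((A.σ i.castSucc)⁻¹ x)
      (Fin.le_def.2 (by dsimp only; lia)) (Fin.le_def.2 (by dsimp only; lia))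
      (by dsimp only; lia), Equiv.Perm.coe_inv, Equiv.apply_symm_apply]
  rw [key]

/-- A single move preserves inverted pairs. -/
theorem inverted_succ (i : Fin m) {p q : Fin n} (hpq : p < q)
    (h : (A.σ i.castSucc)⁻¹ q < (A.σ i.castSucc)⁻¹ p) :
    (A.σ i.succ)⁻¹ q < (A.σ i.succ)⁻¹ p := by
  have hmono := A.mono i ((A.σ i.castSucc)⁻¹ q) ((A.σ i.castSucc)⁻¹ p)
  rw [Equiv.Perm.coe_inv, Equiv.apply_symm_apply, Equiv.apply_symm_apply,
    ← Equiv.Perm.coe_inv] at hmono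
  have hpo := A.inv_succ_of_outside i p
  have hpi := A.inv_succ_of_inside i p
  have hqo := A.inv_succ_of_outside i q
  have hqi := A.inv_succ_of_inside i q
  generalize (A.σ i.castSucc)⁻¹ p = c at *
  generalize (A.σ i.castSucc)⁻¹ q = d at *
  generalize (A.σ i.succ)⁻¹ p = c' at *
  generalize (A.σ i.succ)⁻¹ q = d' at *
  by_cases hp : A.a i ≤ c ∧ c ≤ A.b i <;> by_cases hq : A.a i ≤ d ∧ d ≤ A.b i
  · exact absurd (hmono hq.1 h hp.2) hpq.asymm
  · have := hpi hp.1 hp.2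
    have := hqo (by lia)
    lia
  · have := hqi hq.1 hq.2
    have := hpo (by lia)
    lia
  · have := hpo (by lia)
    have := hqo (by lia)
    lia

/-- Once inverted, a pair stays inverted. -/
theorem inverted_of_le {p q : Fin n} (hpq : p < q) {i j : Fin (m + 1)} (hij : i ≤ j)
    (h : (A.σ i)⁻¹ q < (A.σ i)⁻¹ p) : (A.σ j)⁻¹ q < (A.σ j)⁻¹ p := by
  induction j using Fin.induction with
  | zero => rwa [← Fin.le_zero_iff.1 hij]
  | succ j ih =>
    rcases hij.eq_or_lt with rfl | hlt
    · exact h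
    · exact A.inverted_succ j hpq (ih (Fin.le_castSucc_iff.2 hlt))

theorem not_inverted_zero {p q : Fin n} (hpq : p < q) : ¬ (A.σ 0)⁻¹ q < (A.σ 0)⁻¹ p := by
  simpa [A.sigma_zero] using hpq.le

theorem inverted_last {p q : Fin n} (hpq : p < q) :
    (A.σ (Fin.last m))⁻¹ q < (A.σ (Fin.last m))⁻¹ p := by
  have hinv (x : Fin n) : (A.σ (Fin.last m))⁻¹ x = x.rev := by
    rw [Equiv.Perm.inv_eq_iff_eq, A.sigma_last, Fin.rev_rev]
  simpa [hinv] using hpq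

theorem exists_move_inverting {p q : Fin n} (hpq : p < q) :
    ∃ i : Fin m, ¬ ((A.σ i.castSucc)⁻¹ q < (A.σ i.castSucc)⁻¹ p) ∧
      (A.σ i.succ)⁻¹ q < (A.σ i.succ)⁻¹ p := by
  by_contra hne
  have hnever (j : Fin (m + 1)) : ¬ (A.σ j)⁻¹ q < (A.σ j)⁻¹ p := by
    induction j using Fin.induction with
    | zero => exact A.not_inverted_zero hpq
    | succ j ih => exact fun hj => hne ⟨j, ih, hj⟩
  exact hnever _ (A.inverted_last hpq)

end AllowableSequence

/-- In an allowable sequence, every pair of labels `p < q` gets inverted exactly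
once: (1) once the label `q` occurs before `p`, it stays that way; and (2) there is
exactly one move after which the pair becomes inverted.  (In the wiring diagram
interpretation: every two pseudolines cross exactly once.) -/
theorem pair_inverted_exactly_once (n m : ℕ) (A : AllowableSequence n m) :
    (∀ p q : Fin n, p < q → ∀ i j : Fin (m + 1), i ≤ j →
      (A.σ i)⁻¹ q < (A.σ i)⁻¹ p → (A.σ j)⁻¹ q < (A.σ j)⁻¹ p) ∧
    (∀ p q : Fin n, p < q →
      ∃! i : Fin m, ¬ ((A.σ i.castSucc)⁻¹ q < (A.σ i.castSucc)⁻¹ p) ∧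
        (A.σ i.succ)⁻¹ q < (A.σ i.succ)⁻¹ p) := by
  refine ⟨fun p q hpq i j hij => A.inverted_of_le hpq hij, fun p q hpq => ?_⟩
  have hle {i j : Fin m} (hi : (A.σ i.succ)⁻¹ q < (A.σ i.succ)⁻¹ p)
      (hj : ¬ (A.σ j.castSucc)⁻¹ q < (A.σ j.castSucc)⁻¹ p) : j ≤ i :=
    not_lt.1 fun hij => hj (A.inverted_of_le hpq (Fin.succ_le_castSucc_iff.2 hij) hi)
  obtain ⟨i, hi, hi'⟩ := A.exists_move_inverting hpq
  exact ⟨i, ⟨hi, hi'⟩, fun j hj => le_antisymm (hle hi' hj.1) (hle hj.2 hi)⟩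
end
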